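/- Let the parameters of the bivariate powered exponential model satisfy ρ² ≤ (α11·α22·s11^{α11}·s22^{α22})/(α12²·s12^{2α12}) · inf_{r>0} [ r^{α11+α22−2α12} · exp(2(s12·r)^{α12} − (s11·r)^{α11} − (s22·r)^{α22}) · q^{(3)}_{α11,s11}(r)·q^{(3)}_{α22,s22}(r) / (q^{(3)}_{α12,s12}(r))² ], where the infimum is taken over all r > 0 with q^{(3)}_{α12,s12}(r) ≠ 0. Then the bivariate powered exponential model C is positive definite in ℝ³. -/

import Mathlib

open Matrix Set

noncomputable section

/-- A `2×2`-matrix-valued function `C` on `[0,∞)` is positive definite in `ℝⁿ` if for all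
finitely many points `x₁,…,x_p ∈ ℝⁿ` and vectors `a₁,…,a_p ∈ ℝ²`,
`∑_{i,j} aᵢᵀ C(‖xᵢ - xⱼ‖) aⱼ ≥ 0`. -/
def PosDefIn (n : ℕ) (C : ℝ → Matrix (Fin 2) (Fin 2) ℝ) : Prop :=
  ∀ (p : ℕ) (x : Fin p → EuclideanSpace ℝ (Fin n)) (a : Fin p → Fin 2 → ℝ),
    0 ≤ ∑ i : Fin p, ∑ j : Fin p, a i ⬝ᵥ (C ‖x i - x j‖).mulVec (a j)

/-- The auxiliary function
`q⁽³⁾_{α,s}(r) = α² (s r)^{2α} - 3α² (s r)^α + 4α (s r)^α + α² - 4α + 3`. -/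
def q3 (α s r : ℝ) : ℝ :=
  α ^ 2 * (s * r) ^ (2 * α) - 3 * α ^ 2 * (s * r) ^ α + 4 * α * (s * r) ^ α
    + α ^ 2 - 4 * α + 3


/-- Euclid's hat in dimension three. -/
def hat3 (t d : ℝ) : ℝ :=
  (Ioi d).indicator (fun t => 1 - 3 / 2 * (d / t) + (d / t) ^ 3 / 2) t

/-- profile of disc areas -/
def discProf (R d a : ℝ) : ℝ := Real.pi * max 0 (R ^ 2 - max (a ^ 2) ((a - d) ^ 2))

open MeasureTheory

lemma continuous_discProf (R d : ℝ) : Continuous (discProf R d) := by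
  unfold discProf; fun_prop

lemma discProf_nonneg (R d a : ℝ) : 0 ≤ discProf R d a := by
  unfold discProf; positivity

lemma discProf_support (R d a : ℝ) (hR : 0 < R) (h : a ∉ Ioc (d - R) R) : discProf R d a = 0 := by
  unfold discProf
  have : R ^ 2 - max (a ^ 2) ((a - d) ^ 2) ≤ 0 := by
    rw [sub_nonpos, le_max_iff]
    by_cases ha : a ≤ R
    · right
      have : a ≤ d - R := by
        by_contra hh
        exact h ⟨not_le.1 hh, ha⟩
      nlinarith
    · left
      push Not at ha
      nlinarith
  rw [max_eq_left this, mul_zero]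

lemma discProf_eq_indicator (R d : ℝ) (hR : 0 < R) :
    discProf R d = (Ioc (d - R) R).indicator (discProf R d) := by
  ext a
  by_cases h : a ∈ Ioc (d - R) R
  · rw [indicator_of_mem h]
  · rw [indicator_of_notMem h, discProf_support R d a hR h]

lemma integrable_discProf (R d : ℝ) (hR : 0 < R) : Integrable (discProf R d) := by
  rw [discProf_eq_indicator R d hR, integrable_indicator_iff measurableSet_Ioc]
  exact (continuous_discProf R d).integrableOn_Ioc

lemma integral_discProf (R d : ℝ) (hR : 0 < R) (hd : 0 ≤ d) :
    ∫ a, discProf R d a = Real.pi * (2 * R) ^ 3 / 6 * hat3 (2 * R) d := by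
  rw [discProf_eq_indicator R d hR, integral_indicator measurableSet_Ioc]
  by_cases h : d < 2 * R
  · have hle : d - R ≤ R := by linarith
    rw [← intervalIntegral.integral_of_le hle]
    have hc := continuous_discProf R d
    rw [← intervalIntegral.integral_add_adjacent_intervals
      (hc.intervalIntegrable (d - R) (d / 2)) (hc.intervalIntegrable (d / 2) R)]
    have h1 : ∫ a in (d - R)..(d / 2), discProf R d a
        = ∫ a in (d - R)..(d / 2), Real.pi * (R ^ 2 - (a - d) ^ 2) := by
      apply intervalIntegral.integral_congr
      intro a ha
      rw [uIcc_of_le (by linarith)] at ha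
      obtain ⟨ha1, ha2⟩ := ha
      simp only [discProf]
      rw [max_eq_right (a := a ^ 2) (by nlinarith), max_eq_right (by nlinarith)]
    have h2 : ∫ a in (d / 2)..R, discProf R d a
        = ∫ a in (d / 2)..R, Real.pi * (R ^ 2 - a ^ 2) := by
      apply intervalIntegral.integral_congr
      intro a ha
      rw [uIcc_of_le (by linarith)] at ha
      obtain ⟨ha1, ha2⟩ := ha
      simp only [discProf]
      rw [max_eq_left (a := a ^ 2) (by nlinarith), max_eq_right (by nlinarith)]
    rw [h1, h2]
    have h3 : ∫ a in (d - R)..(d / 2), Real.pi * (R ^ 2 - (a - d) ^ 2)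
        = ∫ a in (-R)..(-d / 2), Real.pi * (R ^ 2 - a ^ 2) := by
      rw [intervalIntegral.integral_comp_sub_right (fun a => Real.pi * (R ^ 2 - a ^ 2)) d]
      congr 1 <;> ring
    have h4 : ∀ u v : ℝ, ∫ a in u..v, Real.pi * (R ^ 2 - a ^ 2)
        = Real.pi * (R ^ 2 * (v - u) - (v ^ 3 - u ^ 3) / 3) := by
      intro u v
      rw [intervalIntegral.integral_const_mul, intervalIntegral.integral_sub
        (by simp) (by apply Continuous.intervalIntegrable; fun_prop), integral_pow]
      simp only [intervalIntegral.integral_const, smul_eq_mul]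
      push_cast
      ring
    rw [h3, h4, h4]
    simp only [hat3]
    rw [indicator_of_mem (by exact h)]
    field_simp
    ring
  · simp only [hat3]
    rw [indicator_of_notMem (by exact h), Ioc_eq_empty (by linarith)]
    simp

lemma volume_disc (c : ℝ) :
    volume {w : Fin 2 → ℝ | w 0 ^ 2 + w 1 ^ 2 < c} = ENNReal.ofReal (Real.pi * max 0 c) := by
  rcases le_or_gt c 0 with hc | hc
  · have : {w : Fin 2 → ℝ | w 0 ^ 2 + w 1 ^ 2 < c} = ∅ := by
      ext w; simp; nlinarith [sq_nonneg (w 0), sq_nonneg (w 1)]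
    rw [this, max_eq_left hc]; simp
  · have h1 : WithLp.toLp 2 ⁻¹' (Metric.ball (0 : EuclideanSpace ℝ (Fin 2)) (Real.sqrt c))
        = {w : Fin 2 → ℝ | w 0 ^ 2 + w 1 ^ 2 < c} := by
      ext w
      simp only [mem_preimage, mem_ball_zero_iff, mem_ofPred_eq]
      rw [← sq_lt_sq₀ (norm_nonneg _) (Real.sqrt_nonneg _), Real.sq_sqrt hc.le,
        EuclideanSpace.norm_sq_eq]
      simp [Fin.sum_univ_two]
    rw [← h1, (PiLp.volume_preserving_toLp (Fin 2)).measure_preimage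
      measurableSet_ball.nullMeasurableSet, EuclideanSpace.volume_ball_fin_two,
      ← ENNReal.ofReal_pow (Real.sqrt_nonneg _), Real.sq_sqrt hc.le,
      ← ENNReal.ofReal_mul hc.le, max_eq_right hc.le, mul_comm]

lemma volume_lens_axis (R d : ℝ) (hR : 0 < R) (hd : 0 ≤ d) :
    volume.real (Metric.ball (EuclideanSpace.single (0 : Fin 3) d) R ∩
      Metric.ball (0 : EuclideanSpace ℝ (Fin 3)) R)
      = Real.pi * (2 * R) ^ 3 / 6 * hat3 (2 * R) d := by
  set S : Set (ℝ × (Fin 2 → ℝ)) :=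
    {z | z.2 0 ^ 2 + z.2 1 ^ 2 < R ^ 2 - max (z.1 ^ 2) ((z.1 - d) ^ 2)} with hS
  have hSm : MeasurableSet S := by
    apply measurableSet_lt <;> fun_prop
  have hpre : (fun z : EuclideanSpace ℝ (Fin 3) =>
      (MeasurableEquiv.piFinSuccAbove (fun _ : Fin 3 => ℝ) 0) (WithLp.ofLp z)) ⁻¹' S
      = Metric.ball (EuclideanSpace.single (0 : Fin 3) d) R ∩
      Metric.ball (0 : EuclideanSpace ℝ (Fin 3)) R := by
    ext z
    simp only [mem_preimage, hS, mem_ofPred_eq, mem_inter_iff,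
      Metric.mem_ball, dist_eq_norm, sub_zero]
    rw [← sq_lt_sq₀ (norm_nonneg z) hR.le, ← sq_lt_sq₀ (norm_nonneg (z - _)) hR.le,
      EuclideanSpace.norm_sq_eq, EuclideanSpace.norm_sq_eq, lt_sub_comm, max_lt_iff]
    have t1 : Fin.tail z.ofLp 0 = z.ofLp 1 := rfl
    have t2 : Fin.tail z.ofLp 1 = z.ofLp 2 := rfl
    simp [Fin.sum_univ_three, t1, t2]
    constructor <;> rintro ⟨h1, h2⟩ <;> constructor <;> linarith
  have hmp : MeasurePreserving (fun z : EuclideanSpace ℝ (Fin 3) =>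
      (MeasurableEquiv.piFinSuccAbove (fun _ : Fin 3 => ℝ) 0) (WithLp.ofLp z)) volume volume :=
    (volume_preserving_piFinSuccAbove (fun _ : Fin 3 => ℝ) 0).comp
      (PiLp.volume_preserving_ofLp (Fin 3))
  rw [← hpre, Measure.real, hmp.measure_preimage hSm.nullMeasurableSet, Measure.volume_eq_prod,
    Measure.prod_apply hSm]
  have hsec : ∀ a : ℝ, volume (Prod.mk a ⁻¹' S) = ENNReal.ofReal (discProf R d a) := by
    intro a
    have := volume_disc (R ^ 2 - max (a ^ 2) ((a - d) ^ 2))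
    simpa only [hS, discProf, preimage_ofPred_eq] using this
  simp_rw [hsec]
  rw [← ofReal_integral_eq_lintegral_ofReal (integrable_discProf R d hR)
    (Filter.Eventually.of_forall (discProf_nonneg R d)),
    ENNReal.toReal_ofReal (integral_nonneg (discProf_nonneg R d)), integral_discProf R d hR hd]

lemma volume_lens (R : ℝ) (hR : 0 < R) (x y : EuclideanSpace ℝ (Fin 3)) :
    volume.real (Metric.ball x R ∩ Metric.ball y R)
      = Real.pi * (2 * R) ^ 3 / 6 * hat3 (2 * R) ‖x - y‖ := by
  rw [← volume_lens_axis R ‖x - y‖ hR (norm_nonneg _)]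
  set v := x - y with hv
  set e := EuclideanSpace.single (0 : Fin 3) ‖v‖ with he
  have hne : ‖v‖ = ‖e‖ := by simp [he]
  have hrefl := Submodule.reflection_sub hne
  set T := (ℝ ∙ (v - e))ᗮ.reflection with hT
  have h1 : (fun z => T (z - y)) ⁻¹' (Metric.ball e R ∩ Metric.ball 0 R)
      = Metric.ball x R ∩ Metric.ball y R := by
    ext z
    simp only [mem_preimage, mem_inter_iff, Metric.mem_ball, dist_eq_norm, sub_zero,
      LinearIsometryEquiv.norm_map]
    rw [← hrefl, ← map_sub, LinearIsometryEquiv.norm_map, hv, sub_sub_sub_cancel_right]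
  have hmp : MeasurePreserving (fun z => T (z - y)) volume volume :=
    T.measurePreserving.comp (measurePreserving_sub_right volume y)
  rw [← h1, Measure.real, Measure.real, hmp.measure_preimage
    (measurableSet_ball.inter measurableSet_ball).nullMeasurableSet]

lemma hat_form_nonneg {p : ℕ} (x : Fin p → EuclideanSpace ℝ (Fin 3)) (a : Fin p → Fin 2 → ℝ)
    (A B D t : ℝ) (ht : 0 < t) (hA : 0 ≤ A) (hD : 0 ≤ D) (hdet : B ^ 2 ≤ A * D) :
    0 ≤ ∑ i, ∑ j, hat3 t ‖x i - x j‖ *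
      (A * (a i 0 * a j 0) + B * (a i 0 * a j 1 + a i 1 * a j 0) + D * (a i 1 * a j 1)) := by
  have hq : ∀ u v : ℝ, 0 ≤ A * (u * u) + B * (u * v + v * u) + D * (v * v) := by
    intro u v
    rcases hA.eq_or_lt with h | h
    · have : B = 0 := by
        rw [← h, zero_mul] at hdet
        exact pow_eq_zero_iff (two_ne_zero) |>.1 (le_antisymm hdet (sq_nonneg B))
      rw [← h, this]; nlinarith [mul_nonneg hD (mul_self_nonneg v)]
    · have h2 : 0 ≤ A * (A * (u * u) + B * (u * v + v * u) + D * (v * v)) := by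
        nlinarith [sq_nonneg (A * u + B * v), mul_nonneg (sub_nonneg.2 hdet) (sq_nonneg v)]
      exact nonneg_of_mul_nonneg_right h2 h
  have hR : 0 < t / 2 := by positivity
  set I : Fin p → EuclideanSpace ℝ (Fin 3) → ℝ :=
    fun i => (Metric.ball (x i) (t / 2)).indicator 1 with hI
  have hII : ∀ i j, (fun z => I i z * I j z) =
      (Metric.ball (x i) (t / 2) ∩ Metric.ball (x j) (t / 2)).indicator 1 := by
    intro i j
    ext z
    simp only [hI]
    rw [inter_indicator_one]; rfl
  have hms : ∀ i j, MeasurableSet (Metric.ball (x i) (t / 2) ∩ Metric.ball (x j) (t / 2)) :=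
    fun i j => measurableSet_ball.inter measurableSet_ball
  have hint : ∀ i j, Integrable (fun z => I i z * I j z) := by
    intro i j
    rw [hII, integrable_indicator_iff (hms i j)]
    refine integrableOn_const (C := (1 : ℝ)) ?_
    exact ((measure_mono inter_subset_left).trans_lt measure_ball_lt_top).ne
  have hval : ∀ i j, ∫ z, I i z * I j z = Real.pi * t ^ 3 / 6 * hat3 t ‖x i - x j‖ := by
    intro i j
    rw [hII, integral_indicator_one (hms i j), volume_lens _ hR]
    congr 2 <;> ring_nf
  have hpos : 0 < Real.pi * t ^ 3 / 6 := by positivity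
  refine nonneg_of_mul_nonneg_right (a := Real.pi * t ^ 3 / 6) ?_ hpos
  have : Real.pi * t ^ 3 / 6 * ∑ i, ∑ j, hat3 t ‖x i - x j‖ *
      (A * (a i 0 * a j 0) + B * (a i 0 * a j 1 + a i 1 * a j 0) + D * (a i 1 * a j 1))
      = ∫ z, ∑ i, ∑ j, (I i z * I j z) *
      (A * (a i 0 * a j 0) + B * (a i 0 * a j 1 + a i 1 * a j 0) + D * (a i 1 * a j 1)) := by
    rw [integral_finsetSum _ (fun i _ => integrable_finsetSum _
      (fun j _ => (hint i j).mul_const _)), Finset.mul_sum]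
    refine Finset.sum_congr rfl fun i _ => ?_
    rw [integral_finsetSum _ (fun j _ => (hint i j).mul_const _), Finset.mul_sum]
    refine Finset.sum_congr rfl fun j _ => ?_
    rw [integral_mul_const, hval]
    ring
  rw [this]
  refine integral_nonneg fun z => ?_
  have h := hq (∑ i, I i z * a i 0) (∑ i, I i z * a i 1)
  rw [Finset.sum_mul_sum, Finset.sum_mul_sum, Finset.sum_mul_sum, Finset.sum_mul_sum] at h
  simp only [Finset.mul_sum, ← Finset.sum_add_distrib] at h
  refine h.trans_eq ?_
  refine Finset.sum_congr rfl fun i _ => Finset.sum_congr rfl fun j _ => ?_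
  ring
/-- mixing density -/
def mixDens (α s t : ℝ) : ℝ :=
  α * s ^ α * t ^ (α - 1) * Real.exp (-(s * t) ^ α) * q3 α s t / 3

lemma integrableOn_term (α b q : ℝ) (hα : 0 < α) (hb : 0 < b) (hq : -1 < q) :
    IntegrableOn (fun t : ℝ => t ^ q * Real.exp (-b * t ^ α)) (Ioi 0) := by
  apply Integrable.of_integral_ne_zero
  rw [integral_rpow_mul_exp_neg_mul_rpow hα hq hb]
  have : 0 < Real.Gamma ((q + 1) / α) := Real.Gamma_pos_of_pos (by apply div_pos <;> linarith)
  positivity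

lemma integrableOn_mixDens (α s : ℝ) (hα : 0 < α) (hs : 0 < s) :
    IntegrableOn (mixDens α s) (Ioi 0) := by
  have hb : 0 < s ^ α := by positivity
  have h0 := (integrableOn_term α (s ^ α) (α - 1) hα hb (by linarith)).const_mul
    (α * s ^ α * (α ^ 2 - 4 * α + 3) / 3)
  have h1 := (integrableOn_term α (s ^ α) (α - 1 + α) hα hb (by linarith)).const_mul
    (α * s ^ α * (4 * α - 3 * α ^ 2) * s ^ α / 3)
  have h2 := (integrableOn_term α (s ^ α) (α - 1 + α + α) hα hb (by linarith)).const_mul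
    (α * s ^ α * α ^ 2 * s ^ α * s ^ α / 3)
  refine Integrable.congr ((h0.add h1).add h2) ?_
  filter_upwards [ae_restrict_mem measurableSet_Ioi] with t ht
  have ht : 0 < t := ht
  simp only [Pi.add_apply, mixDens, q3]
  rw [two_mul, Real.rpow_add (mul_pos hs ht), Real.mul_rpow hs.le ht.le,
    Real.rpow_add ht, Real.rpow_add ht (α - 1 + α), Real.rpow_add ht (α - 1), neg_mul]
  ring

/-- antiderivative -/
def antiD (α s r t : ℝ) : ℝ :=
  Real.exp (-(s * t) ^ α) * (-1 - α * (s * t) ^ α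
    - (α ^ 2 * ((s * t) ^ α) ^ 2 - α * (α - 1) * (s * t) ^ α) / 3
    + r / t / 2 * (α ^ 2 * ((s * t) ^ α) ^ 2 - α * (α - 1) * (s * t) ^ α + 2 * α * (s * t) ^ α)
    - (r / t) ^ 3 * (α ^ 2 * ((s * t) ^ α) ^ 2 - α * (α - 1) * (s * t) ^ α) / 6)

lemma antiD_hasDerivAt (α s r t : ℝ) (hs : 0 < s) (ht : 0 < t) :
    HasDerivAt (antiD α s r)
      ((1 - 3 / 2 * (r / t) + (r / t) ^ 3 / 2) * mixDens α s t) t := by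
  have hu : HasDerivAt (fun t : ℝ => (s * t) ^ α) (α * (s * t) ^ α / t) t := by
    have h := ((hasDerivAt_id t).const_mul s).rpow_const (p := α)
      (Or.inl (mul_pos hs ht).ne')
    refine h.congr_deriv ?_
    simp only [id_eq]
    rw [Real.rpow_sub_one (mul_pos hs ht).ne']
    field_simp
  have hr : HasDerivAt (fun t : ℝ => r / t) (-(r / t) / t) t := by
    have h := (hasDerivAt_inv ht.ne').const_mul r
    refine h.congr_deriv ?_
    field_simp
  have he := hu.fun_neg.exp
  have hQ := ((hu.fun_pow 2).const_mul (α ^ 2)).fun_sub (hu.const_mul (α * (α - 1)))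
  have h1 := ((hu.const_mul α).const_sub (-1)).fun_sub (hQ.div_const 3)
  have h2 := (hr.div_const 2).fun_mul (hQ.fun_add (hu.const_mul (2 * α)))
  have h3 := ((hr.fun_pow 3).fun_mul hQ).div_const 6
  have h := he.fun_mul ((h1.fun_add h2).fun_sub h3)
  refine HasDerivAt.congr_deriv (f := antiD α s r) h ?_
  simp only [mixDens, q3]
  have e1 : s ^ α * t ^ (α - 1) = (s * t) ^ α / t := by
    rw [Real.rpow_sub_one ht.ne', Real.mul_rpow hs.le ht.le]; ring
  rw [mul_assoc α (s ^ α), e1, two_mul α, Real.rpow_add (mul_pos hs ht)]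
  generalize (s * t) ^ α = u
  generalize Real.exp (-u) = E
  push_cast
  field_simp
  ring

lemma antiD_tendsto (α s r : ℝ) (hα : 0 < α) (hs : 0 < s) :
    Filter.Tendsto (antiD α s r) Filter.atTop (nhds 0) := by
  have hu : Filter.Tendsto (fun t : ℝ => (s * t) ^ α) Filter.atTop Filter.atTop :=
    (tendsto_rpow_atTop hα).comp (Filter.tendsto_id.const_mul_atTop hs)
  have hr : Filter.Tendsto (fun t : ℝ => r / t) Filter.atTop (nhds 0) :=
    Filter.tendsto_id.const_div_atTop r
  have e0 := (Real.tendsto_pow_mul_exp_neg_atTop_nhds_zero 0).comp hu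
  have e1 := (Real.tendsto_pow_mul_exp_neg_atTop_nhds_zero 1).comp hu
  have e2 := (Real.tendsto_pow_mul_exp_neg_atTop_nhds_zero 2).comp hu
  have hQ := (e2.const_mul (α ^ 2)).sub (e1.const_mul (α * (α - 1)))
  have h := ((((e0.const_mul (-1)).sub (e1.const_mul α)).sub (hQ.div_const 3)).add
    ((hr.div_const 2).mul (hQ.add (e1.const_mul (2 * α))))).sub
    (((hr.pow 3).mul hQ).div_const 6)
  refine (h.congr ?_).trans (by simp)
  intro t
  simp only [antiD, Function.comp]
  ring

lemma antiD_continuousWithinAt (α s r : ℝ) (hα : 0 < α) (hs : 0 < s) (hr : 0 ≤ r) :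
    ContinuousWithinAt (antiD α s r) (Ici r) r := by
  rcases hr.eq_or_lt with h | h
  · subst h
    have hu : Continuous fun t : ℝ => (s * t) ^ α := by
      apply Continuous.rpow_const (by fun_prop)
      intro x; right; exact hα.le
    apply Continuous.continuousWithinAt
    unfold antiD
    simp only [zero_div]
    fun_prop
  · exact (antiD_hasDerivAt α s r r hs h).continuousAt.continuousWithinAt

lemma antiD_self (α s r : ℝ) (hα : 0 < α) : antiD α s r r = -Real.exp (-(s * r) ^ α) := by
  unfold antiD
  by_cases h : r = 0
  · subst h
    simp [Real.zero_rpow hα.ne']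
  · rw [div_self h]; ring

lemma hat_bound (r t : ℝ) (hr : 0 ≤ r) : ‖hat3 t r‖ ≤ 3 := by
  unfold hat3
  by_cases h : t ∈ Ioi r
  · rw [indicator_of_mem h]
    have h : r < t := h
    have h0 : 0 ≤ r / t := div_nonneg hr (by linarith)
    have h1 : r / t ≤ 1 := (div_le_one (by linarith)).2 h.le
    have h3 : (r / t) ^ 3 ≤ 1 := pow_le_one₀ h0 h1
    have h4 : 0 ≤ (r / t) ^ 3 := by positivity
    rw [Real.norm_eq_abs, abs_le]
    constructor <;> linarith
  · rw [indicator_of_notMem h]; simp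

lemma hat_mix_integrable (α s r : ℝ) (hα : 0 < α) (hs : 0 < s) (hr : 0 ≤ r) :
    IntegrableOn (fun t => hat3 t r * mixDens α s t) (Ioi 0) := by
  refine (integrableOn_mixDens α s hα hs).bdd_mul (c := 3) ?_
    (Filter.Eventually.of_forall fun t => hat_bound r t hr)
  apply Measurable.aestronglyMeasurable
  unfold hat3
  exact Measurable.indicator (by fun_prop) measurableSet_Ioi

lemma hat_mix_integral (α s r : ℝ) (hα : 0 < α) (hs : 0 < s) (hr : 0 ≤ r) :
    ∫ t in Ioi 0, hat3 t r * mixDens α s t = Real.exp (-(s * r) ^ α) := by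
  have hi := hat_mix_integrable α s r hα hs hr
  have heq : (fun t => hat3 t r * mixDens α s t) = (Ioi r).indicator
      (fun t => (1 - 3 / 2 * (r / t) + (r / t) ^ 3 / 2) * mixDens α s t) := by
    ext t
    unfold hat3
    rw [indicator_mul_left]
  rw [heq] at hi ⊢
  have hsub : Ioi r ⊆ Ioi (0 : ℝ) := Ioi_subset_Ioi hr
  rw [setIntegral_indicator measurableSet_Ioi, inter_eq_right.2 hsub]
  rw [integral_Ioi_of_hasDerivAt_of_tendsto (antiD_continuousWithinAt α s r hα hs hr)
    (fun t ht => antiD_hasDerivAt α s r t hs (lt_of_le_of_lt hr ht)) ?_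
    (antiD_tendsto α s r hα hs), antiD_self α s r hα]
  · ring
  · have := hi.mono_set hsub
    refine this.congr_fun ?_ measurableSet_Ioi
    intro t ht
    rw [indicator_of_mem ht]

lemma q3_pos (α s t : ℝ) (h : α ∈ Ioc (0 : ℝ) 1) (hs : 0 < s) (ht : 0 < t) : 0 < q3 α s t := by
  obtain ⟨h0, h1⟩ := h
  unfold q3
  rw [two_mul, Real.rpow_add (mul_pos hs ht)]
  have hu : 0 < (s * t) ^ α := Real.rpow_pos_of_pos (mul_pos hs ht) _
  generalize (s * t) ^ α = u at *
  have a1 : 0 < α ^ 2 * (u * u) := by positivity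
  have a2 : 0 ≤ α * u * (4 - 3 * α) := mul_nonneg (by positivity) (by linarith)
  have a3 : 0 ≤ (1 - α) * (3 - α) := mul_nonneg (by linarith) (by linarith)
  nlinarith

lemma mixDens_det (s11 s12 s22 α11 α12 α22 ρ : ℝ)
    (hs11 : 0 < s11) (hs12 : 0 < s12) (hs22 : 0 < s22)
    (hα11 : α11 ∈ Ioc (0 : ℝ) 1) (hα22 : α22 ∈ Ioc (0 : ℝ) 1)
    (hα12 : α12 ∈ Ioc (0 : ℝ) 2)
    (hρ2 : ρ ^ 2 ≤ α11 * α22 * s11 ^ α11 * s22 ^ α22 / (α12 ^ 2 * s12 ^ (2 * α12)) *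
      sInf ((fun r : ℝ =>
          r ^ (α11 + α22 - 2 * α12) *
            Real.exp (2 * (s12 * r) ^ α12 - (s11 * r) ^ α11 - (s22 * r) ^ α22) *
            (q3 α11 s11 r * q3 α22 s22 r) / (q3 α12 s12 r) ^ 2) ''
        {r : ℝ | 0 < r ∧ q3 α12 s12 r ≠ 0})) (t : ℝ) (ht : 0 < t) :
    (ρ * mixDens α12 s12 t) ^ 2 ≤ mixDens α11 s11 t * mixDens α22 s22 t := by
  have p1 := q3_pos α11 s11 t hα11 hs11 ht
  have p2 := q3_pos α22 s22 t hα22 hs22 ht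
  have h1 := hα11.1
  have h2 := hα22.1
  have h12 := hα12.1
  by_cases hq : q3 α12 s12 t = 0
  · have : mixDens α12 s12 t = 0 := by simp [mixDens, hq]
    rw [this]
    unfold mixDens
    simp only [mul_zero, ne_eq, OfNat.ofNat_ne_zero, not_false_eq_true, zero_pow]
    positivity
  · have hle : sInf ((fun r : ℝ =>
          r ^ (α11 + α22 - 2 * α12) *
            Real.exp (2 * (s12 * r) ^ α12 - (s11 * r) ^ α11 - (s22 * r) ^ α22) *
            (q3 α11 s11 r * q3 α22 s22 r) / (q3 α12 s12 r) ^ 2) ''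
        {r : ℝ | 0 < r ∧ q3 α12 s12 r ≠ 0}) ≤ t ^ (α11 + α22 - 2 * α12) *
            Real.exp (2 * (s12 * t) ^ α12 - (s11 * t) ^ α11 - (s22 * t) ^ α22) *
            (q3 α11 s11 t * q3 α22 s22 t) / (q3 α12 s12 t) ^ 2 := by
      apply csInf_le
      · refine ⟨0, ?_⟩
        rintro _ ⟨r, ⟨hr, -⟩, rfl⟩
        have p1 := q3_pos α11 s11 r hα11 hs11 hr
        have p2 := q3_pos α22 s22 r hα22 hs22 hr
        positivity
      · exact ⟨t, ⟨ht, hq⟩, rfl⟩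
    have hρ' := hρ2.trans (mul_le_mul_of_nonneg_left hle (by positivity))
    rw [mul_pow]
    refine (mul_le_mul_of_nonneg_right hρ' (sq_nonneg _)).trans_eq ?_
    unfold mixDens
    rw [two_mul α12, Real.rpow_add hs12, Real.rpow_sub ht, Real.rpow_add ht, Real.rpow_add ht,
      Real.exp_sub, Real.exp_sub, two_mul ((s12 * t) ^ α12), Real.exp_add,
      Real.rpow_sub_one ht.ne', Real.rpow_sub_one ht.ne', Real.rpow_sub_one ht.ne',
      Real.exp_neg, Real.exp_neg, Real.exp_neg]
    have := Real.exp_pos ((s12 * t) ^ α12)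
    have := Real.exp_pos ((s11 * t) ^ α11)
    have := Real.exp_pos ((s22 * t) ^ α22)
    have := Real.rpow_pos_of_pos hs12 α12
    have := Real.rpow_pos_of_pos ht α12
    field_simp

/-- Sufficient condition for positive definiteness of the bivariate powered exponential
model in `ℝ³`. -/
theorem bivariate_powered_exponential_posDef_R3
    (σ1 σ2 s11 s12 s22 α11 α12 α22 ρ : ℝ)
    (hσ1 : 0 < σ1) (hσ2 : 0 < σ2)
    (hs11 : 0 < s11) (hs12 : 0 < s12) (hs22 : 0 < s22)
    (hα11 : α11 ∈ Ioc (0 : ℝ) 1) (hα22 : α22 ∈ Ioc (0 : ℝ) 1)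
    (hα12 : α12 ∈ Ioc (0 : ℝ) 2)
    (hρ : ρ ∈ Icc (-1 : ℝ) 1)
    (hρ2 : ρ ^ 2 ≤ α11 * α22 * s11 ^ α11 * s22 ^ α22 / (α12 ^ 2 * s12 ^ (2 * α12)) *
      sInf ((fun r : ℝ =>
          r ^ (α11 + α22 - 2 * α12) *
            Real.exp (2 * (s12 * r) ^ α12 - (s11 * r) ^ α11 - (s22 * r) ^ α22) *
            (q3 α11 s11 r * q3 α22 s22 r) / (q3 α12 s12 r) ^ 2) ''
        {r : ℝ | 0 < r ∧ q3 α12 s12 r ≠ 0})) :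
    PosDefIn 3 (fun r =>
      !![σ1 ^ 2 * Real.exp (-(s11 * r) ^ α11), ρ * σ1 * σ2 * Real.exp (-(s12 * r) ^ α12);
         ρ * σ1 * σ2 * Real.exp (-(s12 * r) ^ α12), σ2 ^ 2 * Real.exp (-(s22 * r) ^ α22)]) := by
  intro p x a
  simp only [Matrix.mulVec, dotProduct, Fin.sum_univ_two, Matrix.of_apply, Matrix.cons_val_zero,
    Matrix.cons_val_one]
  have hint : ∀ i j : Fin p, IntegrableOn (fun t => hat3 t ‖x i - x j‖ *
      ((σ1 ^ 2 * mixDens α11 s11 t) * (a i 0 * a j 0)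
        + (ρ * σ1 * σ2 * mixDens α12 s12 t) * (a i 0 * a j 1 + a i 1 * a j 0)
        + (σ2 ^ 2 * mixDens α22 s22 t) * (a i 1 * a j 1))) (Ioi 0) ∧
      ∫ t in Ioi 0, hat3 t ‖x i - x j‖ *
      ((σ1 ^ 2 * mixDens α11 s11 t) * (a i 0 * a j 0)
        + (ρ * σ1 * σ2 * mixDens α12 s12 t) * (a i 0 * a j 1 + a i 1 * a j 0)
        + (σ2 ^ 2 * mixDens α22 s22 t) * (a i 1 * a j 1)) =
      σ1 ^ 2 * (a i 0 * a j 0) * Real.exp (-(s11 * ‖x i - x j‖) ^ α11)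
      + ρ * σ1 * σ2 * (a i 0 * a j 1 + a i 1 * a j 0) * Real.exp (-(s12 * ‖x i - x j‖) ^ α12)
      + σ2 ^ 2 * (a i 1 * a j 1) * Real.exp (-(s22 * ‖x i - x j‖) ^ α22) := by
    intro i j
    have hr := norm_nonneg (x i - x j)
    have k1 := (hat_mix_integrable α11 s11 _ hα11.1 hs11 hr).const_mul
      (σ1 ^ 2 * (a i 0 * a j 0))
    have k2 := (hat_mix_integrable α12 s12 _ hα12.1 hs12 hr).const_mul
      (ρ * σ1 * σ2 * (a i 0 * a j 1 + a i 1 * a j 0))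
    have k3 := (hat_mix_integrable α22 s22 _ hα22.1 hs22 hr).const_mul
      (σ2 ^ 2 * (a i 1 * a j 1))
    have e : (fun t => hat3 t ‖x i - x j‖ *
      ((σ1 ^ 2 * mixDens α11 s11 t) * (a i 0 * a j 0)
        + (ρ * σ1 * σ2 * mixDens α12 s12 t) * (a i 0 * a j 1 + a i 1 * a j 0)
        + (σ2 ^ 2 * mixDens α22 s22 t) * (a i 1 * a j 1))) =
      fun t => σ1 ^ 2 * (a i 0 * a j 0) * (hat3 t ‖x i - x j‖ * mixDens α11 s11 t)
        + ρ * σ1 * σ2 * (a i 0 * a j 1 + a i 1 * a j 0) *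
          (hat3 t ‖x i - x j‖ * mixDens α12 s12 t)
        + σ2 ^ 2 * (a i 1 * a j 1) * (hat3 t ‖x i - x j‖ * mixDens α22 s22 t) := by
      ext t; ring
    rw [e]
    refine ⟨Integrable.add (Integrable.add k1 k2) k3, ?_⟩
    rw [integral_add (by exact Integrable.add k1 k2) k3, integral_add k1 k2, integral_const_mul,
      integral_const_mul, integral_const_mul, hat_mix_integral α11 s11 _ hα11.1 hs11 hr,
      hat_mix_integral α12 s12 _ hα12.1 hs12 hr, hat_mix_integral α22 s22 _ hα22.1 hs22 hr]
  have key : 0 ≤ ∫ t in Ioi (0 : ℝ), ∑ i, ∑ j, hat3 t ‖x i - x j‖ *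
      ((σ1 ^ 2 * mixDens α11 s11 t) * (a i 0 * a j 0)
        + (ρ * σ1 * σ2 * mixDens α12 s12 t) * (a i 0 * a j 1 + a i 1 * a j 0)
        + (σ2 ^ 2 * mixDens α22 s22 t) * (a i 1 * a j 1)) := by
    refine setIntegral_nonneg measurableSet_Ioi fun t ht => ?_
    have ht : 0 < t := ht
    have p1 := q3_pos α11 s11 t hα11 hs11 ht
    have p2 := q3_pos α22 s22 t hα22 hs22 ht
    have h1 := hα11.1
    have h2 := hα22.1
    have hdet := mixDens_det s11 s12 s22 α11 α12 α22 ρ hs11 hs12 hs22 hα11 hα22 hα12 hρ2 t ht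
    refine hat_form_nonneg x a _ _ _ t ht ?_ ?_ ?_
    · unfold mixDens; positivity
    · unfold mixDens; positivity
    · have := mul_le_mul_of_nonneg_left hdet (by positivity : 0 ≤ σ1 ^ 2 * σ2 ^ 2)
      linarith
  rw [integral_finsetSum _ (fun i _ => integrable_finsetSum _ (fun j _ => (hint i j).1))] at key
  refine key.trans_eq (Finset.sum_congr rfl fun i _ => ?_)
  rw [integral_finsetSum _ (fun j _ => (hint i j).1)]
  refine Finset.sum_congr rfl fun j _ => ?_
  rw [(hint i j).2]
  ring
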